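/- arXiv:1609.02250 — 2 statements merged into one kernel-verified Lean document; each statement's English description precedes it below -/
import Mathlib

section
/- Let u_4 = x_1x_2x_3^2x_4^2x_5^3 and let p_1 = x_1x_2x_3x_4^2x_5^4 + x_1x_2x_3^2x_4x_5^4 + x_1x_2x_3^2x_4^4x_5 + x_1x_2^2x_3x_4x_5^4 + x_1x_2^2x_3x_4^4x_5 + x_1x_2^2x_3^4x_4x_5, and p_2 = x_1x_2x_3x_4^2x_5^4 + x_1x_2x_3^2x_4x_5^4 + x_1x_2x_3^2x_4^4x_5 + x_1x_2x_3^2x_4^2x_5^3 + x_1x_2x_3^2x_4^3x_5^2 + x_1x_2x_3^3x_4^2x_5^2 + x_1x_2^2x_3x_4^2x_5^3 + x_1x_2^2x_3x_4^3x_5^2 + x_1x_2^2x_3^2x_4x_5^3 + x_1x_2^2x_3^2x_4^3x_5 + x_1x_2^2x_3^3x_4x_5^2 + x_1x_2^2x_3^3x_4^2x_5 + x_1x_2^3x_3x_4^2x_5^2 + x_1x_2^3x_3^2x_4x_5^2 + x_1x_2^3x_3^2x_4^2x_5 + x_1^3x_2x_3x_4^2x_5^2 + x_1^3x_2x_3^2x_4x_5^2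 + x_1^3x_2x_3^2x_4^2x_5. Then: (i) an F_2-linear combination f of the monomials σ·u_4 (σ ranging over all permutations of the variables x_1,...,x_5) satisfies 'σ·f − f is hit for every permutation σ' if and only if f is congruent modulo hit polynomials to one of 0, p_1, p_2, p_1 + p_2; and (ii) the classes of p_1 and p_2 in (QP_5)_9 are linearly independent over F_2. -/
open MvPolynomial

noncomputable section

/-- The polynomial algebra `P_5 = F_2[x_1,...,x_5]`. -/
abbrev P5 : Type := MvPolynomial (Fin 5) (ZMod 2)

/-- The total Steenrod square: the `F_2`-algebra endomorphism with `Sq (x_i) = x_i + x_i ^ 2`. -/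
def Sq : P5 →ₐ[ZMod 2] P5 := aeval fun i => X i + X i ^ 2

/-- `f` (homogeneous of degree `n`) is hit if it is the degree-`n` homogeneous component of
`Sq g` for some `g` all of whose homogeneous components have degree `< n`. -/
def IsHit (n : ℕ) (f : P5) : Prop :=
  ∃ g : P5, (∀ m, n ≤ m → homogeneousComponent m g = 0) ∧
    f = homogeneousComponent n (Sq g)

/-- The subspace of hit polynomials of degree `n`. -/
def hitSpan (n : ℕ) : Submodule (ZMod 2) P5 :=
  Submodule.span (ZMod 2) {f : P5 | IsHit n f}

/-- The action of `GL_5(F_2)` on `P_5` by linear substitution of the variables. -/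
def actGL (g : Matrix.GeneralLinearGroup (Fin 5) (ZMod 2)) : P5 →ₐ[ZMod 2] P5 :=
  aeval fun i => ∑ j, ((g : Matrix (Fin 5) (Fin 5) (ZMod 2)) i j) • X j

/-- `wt d i` is the `(i+1)`-st entry `ω_{i+1}` of the weight vector of the monomial with
exponent vector `d`, i.e. the number of `j` such that bit `i` of `d j` is `1`. -/
def wt (d : Fin 5 →₀ ℕ) (i : ℕ) : ℕ :=
  (Finset.univ.filter fun j : Fin 5 => Nat.testBit (d j) i).card

/-- The weight vector of the exponent vector `d` equals the (finitely supported) list `w`. -/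
def hasWt (d : Fin 5 →₀ ℕ) (w : List ℕ) : Prop :=
  ∀ i, wt d i = w.getD i 0

/-- The weight vector of `d` is strictly smaller than `w` in left lexicographic order. -/
def wtLt (d : Fin 5 →₀ ℕ) (w : List ℕ) : Prop :=
  ∃ i, (∀ j, j < i → wt d j = w.getD j 0) ∧ wt d i < w.getD i 0

/-- `P_5^-(ω)`: the span of degree-`n` monomials whose weight vector is `< w`. -/
def PMinus (n : ℕ) (w : List ℕ) : Submodule (ZMod 2) P5 :=
  Submodule.span (ZMod 2)
    {x : P5 | ∃ d : Fin 5 →₀ ℕ, x = monomial d 1 ∧ (∑ j, d j) = n ∧ wtLt d w}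

/-- `P_5(ω)`: the span of degree-`n` monomials whose weight vector is `≤ w`. -/
def PLe (n : ℕ) (w : List ℕ) : Submodule (ZMod 2) P5 :=
  Submodule.span (ZMod 2)
    {x : P5 | ∃ d : Fin 5 →₀ ℕ, x = monomial d 1 ∧ (∑ j, d j) = n ∧ (wtLt d w ∨ hasWt d w)}

/-- The monomial `x_1^a x_2^b x_3^c x_4^d x_5^e`. -/
def mon (a b c d e : ℕ) : P5 :=
  X 0 ^ a * X 1 ^ b * X 2 ^ c * X 3 ^ d * X 4 ^ e

/-- `u_4 = x_1 x_2 x_3^2 x_4^2 x_5^3`. -/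
def u4 : P5 := mon 1 1 2 2 3

def p1 : P5 :=
  mon 1 1 1 2 4 + mon 1 1 2 1 4 + mon 1 1 2 4 1 +
  mon 1 2 1 1 4 + mon 1 2 1 4 1 + mon 1 2 4 1 1

def p2 : P5 :=
  mon 1 1 1 2 4 + mon 1 1 2 1 4 + mon 1 1 2 4 1 + mon 1 1 2 2 3 + mon 1 1 2 3 2 +
  mon 1 1 3 2 2 + mon 1 2 1 2 3 + mon 1 2 1 3 2 + mon 1 2 2 1 3 + mon 1 2 2 3 1 +
  mon 1 2 3 1 2 + mon 1 2 3 2 1 + mon 1 3 1 2 2 + mon 1 3 2 1 2 + mon 1 3 2 2 1 +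
  mon 3 1 1 2 2 + mon 3 1 2 1 2 + mon 3 1 2 2 1

/-- The monomial with exponent vector `v`. -/
def expMono (v : Fin 5 → ℕ) : P5 := monomial (Finsupp.equivFunOnFinite.symm v) 1

/-- The sum of the monomials whose exponent vectors lie in `S`. -/
def monoSum (S : Finset (Fin 5 → ℕ)) : P5 := ∑ v ∈ S, expMono v

/-- The linear functional adding up the coefficients at the exponent vectors in `S`. -/
def coeffSum (S : Finset (Fin 5 → ℕ)) : P5 →ₗ[ZMod 2] ZMod 2 :=
  ∑ v ∈ S, lcoeff (ZMod 2) (Finsupp.equivFunOnFinite.symm v)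

/-- The coefficient of `x ^ n` in `(x + x ^ 2) ^ a`. -/
def sqPowCoeff (a n : ℕ) : ℕ := if a ≤ n then a.choose (n - a) else 0

/-- The coefficient of the monomial with exponents `b` in the total square of the monomial
with exponents `a`. -/
def sqCoeff (a b : Fin 5 → ℕ) : ℕ := ∏ i, sqPowCoeff (a i) (b i)

/-- The exponent vectors of the terms of degree `n` in the total square of the monomial with
exponents `a`. -/
def sqTerms (n : ℕ) (a : Fin 5 → ℕ) : Finset (Fin 5 → ℕ) :=
  (Fintype.piFinset fun i => Finset.Icc (a i) (2 * a i)).filter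
    fun b => ∑ i, b i = n ∧ sqCoeff a b % 2 = 1

theorem coeff_expMono (v w : Fin 5 → ℕ) :
    coeff (Finsupp.equivFunOnFinite.symm w) (expMono v) = if v = w then 1 else 0 := by
  simp [expMono, coeff_monomial]

theorem coeff_monoSum (S : Finset (Fin 5 → ℕ)) (w : Fin 5 → ℕ) :
    coeff (Finsupp.equivFunOnFinite.symm w) (monoSum S) = if w ∈ S then 1 else 0 := by
  simp [monoSum, coeff_sum, coeff_expMono]

theorem coeffSum_apply (S : Finset (Fin 5 → ℕ)) (f : P5) :
    coeffSum S f = ∑ v ∈ S, coeff (Finsupp.equivFunOnFinite.symm v) f := by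
  simp [coeffSum]

theorem ext_expVec {f g : P5} (h : ∀ v : Fin 5 → ℕ,
    coeff (Finsupp.equivFunOnFinite.symm v) f = coeff (Finsupp.equivFunOnFinite.symm v) g) :
    f = g := by
  ext d
  simpa using h d

theorem degree_expVec (v : Fin 5 → ℕ) :
    (Finsupp.equivFunOnFinite.symm v).degree = ∑ i, v i := by
  simp [Finsupp.degree_eq_sum]

theorem X_add_sq_pow (i : Fin 5) (a : ℕ) :
    (X i + X i ^ 2 : P5) ^ a =
      ∑ n ∈ Finset.range (2 * a + 1), C (sqPowCoeff a n : ZMod 2) * X i ^ n := by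
  have h : (X i + X i ^ 2 : P5) = X i * (X i + 1) := by ring
  rw [h, mul_pow, add_pow, Finset.mul_sum, show 2 * a + 1 = a + (a + 1) by ring,
    Finset.sum_range_add _ a (a + 1),
    Finset.sum_eq_zero (s := Finset.range a), zero_add]
  · refine Finset.sum_congr rfl fun n _ => ?_
    simp [sqPowCoeff]
    ring
  · intro n hn
    simp [sqPowCoeff, (Finset.mem_range.mp hn).not_ge]

theorem sqCoeff_eq_zero_of_notMem {a b : Fin 5 → ℕ}
    (h : b ∉ Fintype.piFinset fun i => Finset.Icc (a i) (2 * a i)) : sqCoeff a b = 0 := by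
  simp only [Fintype.mem_piFinset, not_forall, Finset.mem_Icc] at h
  obtain ⟨i, hi⟩ := h
  refine Finset.prod_eq_zero (Finset.mem_univ i) ?_
  unfold sqPowCoeff
  split_ifs with h
  · exact Nat.choose_eq_zero_of_lt (by omega)
  · rfl

theorem Sq_expMono (a : Fin 5 → ℕ) : Sq (expMono a) = ∏ i, (X i + X i ^ 2) ^ a i := by
  rw [expMono, Sq, aeval_monomial]
  simp [Finsupp.prod_fintype]

theorem coeff_Sq_expMono (a b : Fin 5 → ℕ) :
    coeff (Finsupp.equivFunOnFinite.symm b) (Sq (expMono a)) = (sqCoeff a b : ZMod 2) := by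
  have h (p : Fin 5 → ℕ) : ∏ i, (C (sqPowCoeff (a i) (p i) : ZMod 2) * X i ^ p i : P5) =
      (sqCoeff a p : ZMod 2) • expMono p := by
    rw [expMono, monomial_eq, Finset.prod_mul_distrib, smul_eq_C_mul]
    simp [sqCoeff, Finsupp.prod_fintype]
  rw [Sq_expMono]
  simp_rw [X_add_sq_pow]
  rw [Finset.prod_univ_sum, coeff_sum]
  simp_rw [h, coeff_smul, coeff_expMono]
  simp only [smul_eq_mul, mul_ite, mul_one, mul_zero, Finset.sum_ite_eq']
  split_ifs with hb
  · rfl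
  · rw [sqCoeff_eq_zero_of_notMem, Nat.cast_zero]
    refine fun hb' => hb ?_
    simp only [Fintype.mem_piFinset, Finset.mem_Icc, Finset.mem_range] at hb' ⊢
    exact fun i => by have := hb' i; omega

theorem homogeneousComponent_Sq_expMono (n : ℕ) (a : Fin 5 → ℕ) :
    homogeneousComponent n (Sq (expMono a)) = monoSum (sqTerms n a) := by
  refine ext_expVec fun b => ?_
  rw [coeff_homogeneousComponent, coeff_monoSum, coeff_Sq_expMono, degree_expVec]
  by_cases hb : b ∈ Fintype.piFinset fun i => Finset.Icc (a i) (2 * a i)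
  · by_cases hn : ∑ i, b i = n
    · rcases Nat.mod_two_eq_zero_or_one (sqCoeff a b) with h | h
      · simpa [sqTerms, hb, hn, h] using (ZMod.natCast_eq_zero_iff_even.mpr (Nat.even_iff.mpr h))
      · simpa [sqTerms, hb, hn, h] using (ZMod.natCast_eq_one_iff_odd.mpr (Nat.odd_iff.mpr h))
    · simp [sqTerms, hn]
  · simp only [sqTerms, Finset.mem_filter, hb, sqCoeff_eq_zero_of_notMem hb]
    simp

/-- The hit polynomials of degree `n` form a subspace. -/
def hit (n : ℕ) : Submodule (ZMod 2) P5 where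
  carrier := {f | IsHit n f}
  zero_mem' := ⟨0, by simp, by simp⟩
  add_mem' := by
    rintro _ _ ⟨g, hg, rfl⟩ ⟨g', hg', rfl⟩
    exact ⟨g + g', fun m hm => by simp [hg m hm, hg' m hm], by simp⟩
  smul_mem' := by
    rintro c _ ⟨g, hg, rfl⟩
    exact ⟨c • g, fun m hm => by simp [hg m hm], by simp⟩

theorem mem_hit {n : ℕ} {f : P5} : f ∈ hit n ↔ IsHit n f := Iff.rfl

theorem monoSum_sqTerms_mem_hit {n : ℕ} {a : Fin 5 → ℕ} (ha : ∑ i, a i < n) :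
    monoSum (sqTerms n a) ∈ hit n := by
  refine ⟨expMono a, fun m hm => ext_expVec fun b => ?_, (homogeneousComponent_Sq_expMono n a).symm⟩
  rw [coeff_homogeneousComponent, coeff_expMono, degree_expVec, coeff_zero]
  split_ifs with h₁ h₂
  · subst h₂; omega
  all_goals rfl

theorem coeff_rename_expVec (σ : Equiv.Perm (Fin 5)) (w : Fin 5 → ℕ) (f : P5) :
    coeff (Finsupp.equivFunOnFinite.symm w) (rename σ f) =
      coeff (Finsupp.equivFunOnFinite.symm (w ∘ σ)) f := by
  have h : Finsupp.equivFunOnFinite.symm w =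
      (Finsupp.equivFunOnFinite.symm (w ∘ σ)).mapDomain σ := by
    rw [← Finsupp.equivMapDomain_eq_mapDomain]
    ext i
    simp
  rw [h, coeff_rename_mapDomain _ σ.injective]

theorem homogeneousComponent_rename_perm (n : ℕ) (σ : Equiv.Perm (Fin 5)) (f : P5) :
    homogeneousComponent n (rename σ f) = rename σ (homogeneousComponent n f) := by
  refine ext_expVec fun b => ?_
  rw [coeff_rename_expVec, coeff_homogeneousComponent, coeff_homogeneousComponent,
    coeff_rename_expVec, degree_expVec, degree_expVec]
  simp only [Function.comp_apply, Equiv.sum_comp σ b]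

theorem Sq_rename (σ : Equiv.Perm (Fin 5)) (f : P5) : Sq (rename σ f) = rename σ (Sq f) := by
  have h : Sq.comp (rename σ) = (rename σ).comp Sq := by
    ext i
    simp [Sq]
  exact DFunLike.congr_fun h f

theorem rename_mem_hit {n : ℕ} (σ : Equiv.Perm (Fin 5)) {f : P5} (hf : f ∈ hit n) :
    rename σ f ∈ hit n := by
  obtain ⟨g, hg, rfl⟩ := hf
  refine ⟨rename σ g, fun m hm => ?_, ?_⟩
  · rw [homogeneousComponent_rename_perm, hg m hm, map_zero]
  · rw [Sq_rename, homogeneousComponent_rename_perm]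

theorem eq_sum_expMono (g : P5) : g = ∑ d ∈ g.support, coeff d g • expMono d := by
  conv_lhs => rw [g.as_sum]
  refine Finset.sum_congr rfl fun d _ => ?_
  simp [expMono, smul_monomial]

/-- A functional adding up coefficients of degree `n` kills the hit polynomials as soon as it
kills the total squares of monomials of smaller degree. -/
theorem coeffSum_hit {n : ℕ} {S : Finset (Fin 5 → ℕ)} (hS : ∀ b ∈ S, ∑ i, b i = n)
    (h : ∀ a : Fin 5 → ℕ, ∑ i, a i < n → Even (∑ b ∈ S, sqCoeff a b)) {f : P5}
    (hf : f ∈ hit n) : coeffSum S f = 0 := by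
  obtain ⟨g, hg, rfl⟩ := hf
  have key : coeffSum S (homogeneousComponent n (Sq g)) = coeffSum S (Sq g) := by
    rw [coeffSum_apply, coeffSum_apply]
    refine Finset.sum_congr rfl fun b hb => ?_
    rw [coeff_homogeneousComponent, degree_expVec, if_pos (hS b hb)]
  rw [key, eq_sum_expMono g, map_sum, map_sum]
  refine Finset.sum_eq_zero fun d hd => ?_
  have hdeg : ∑ i, d i < n := by
    by_contra! hn
    have h0 := congrArg (coeff d) (hg _ hn)
    rw [coeff_homogeneousComponent, if_pos (Finsupp.degree_eq_sum d), coeff_zero] at h0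
    exact mem_support_iff.mp hd h0
  rw [map_smul, map_smul, coeffSum_apply]
  simp_rw [coeff_Sq_expMono]
  rw [← Nat.cast_sum, ZMod.natCast_eq_zero_iff_even.mpr (h d hdeg), smul_zero]

theorem coeffSum_expMono (S : Finset (Fin 5 → ℕ)) (v : Fin 5 → ℕ) :
    coeffSum S (expMono v) = if v ∈ S then 1 else 0 := by
  simp [coeffSum_apply, coeff_expMono]

theorem rename_expMono (σ : Equiv.Perm (Fin 5)) (v : Fin 5 → ℕ) :
    rename σ (expMono v) = expMono (v ∘ σ.symm) := by
  refine ext_expVec fun w => ?_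
  rw [coeff_rename_expVec, coeff_expMono, coeff_expMono]
  simp only [Equiv.comp_symm_eq]

theorem coeffSum_rename_monoSum (S P : Finset (Fin 5 → ℕ)) (σ : Equiv.Perm (Fin 5)) :
    coeffSum S (rename σ (monoSum P)) = ((P.filter fun v => v ∘ σ.symm ∈ S).card : ZMod 2) := by
  simp [monoSum, rename_expMono, coeffSum_expMono]

theorem monoSum_add_monoSum (A B : Finset (Fin 5 → ℕ)) :
    monoSum A + monoSum B = monoSum (symmDiff A B) := by
  refine ext_expVec fun v => ?_
  simp only [coeff_add, coeff_monoSum, Finset.mem_symmDiff]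
  by_cases hA : v ∈ A <;> by_cases hB : v ∈ B <;> simp [hA, hB, CharTwo.add_self_eq_zero]

theorem expMono_mem_of_monoSum_mem {R : Submodule (ZMod 2) P5} {A : Finset (Fin 5 → ℕ)}
    (hA : monoSum A ∈ R) {v : Fin 5 → ℕ} (hv : v ∈ A)
    (h : ∀ w ∈ A, w ≠ v → expMono w ∈ R) : expMono v ∈ R := by
  rw [monoSum, ← Finset.add_sum_erase _ _ hv] at hA
  refine (Submodule.add_mem_iff_left _ (Submodule.sum_mem _ fun w hw => ?_)).mp hA
  exact h w (Finset.mem_of_mem_erase hw) (Finset.ne_of_mem_erase hw)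

theorem expMono_eq_mon (a b c d e : ℕ) : expMono ![a, b, c, d, e] = mon a b c d e := by
  rw [expMono, monomial_eq, Finsupp.prod_fintype _ _ (by simp), Fin.prod_univ_five]
  simp [mon]

/-- The exponent vectors of the terms of `p1`. -/
def p1Terms : Finset (Fin 5 → ℕ) :=
  {![1, 1, 1, 2, 4], ![1, 1, 2, 1, 4], ![1, 1, 2, 4, 1],
   ![1, 2, 1, 1, 4], ![1, 2, 1, 4, 1], ![1, 2, 4, 1, 1]}

/-- The exponent vectors of the terms of `p2`. -/
def p2Terms : Finset (Fin 5 → ℕ) :=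
  {![1, 1, 1, 2, 4], ![1, 1, 2, 1, 4], ![1, 1, 2, 4, 1], ![1, 1, 2, 2, 3], ![1, 1, 2, 3, 2],
   ![1, 1, 3, 2, 2], ![1, 2, 1, 2, 3], ![1, 2, 1, 3, 2], ![1, 2, 2, 1, 3], ![1, 2, 2, 3, 1],
   ![1, 2, 3, 1, 2], ![1, 2, 3, 2, 1], ![1, 3, 1, 2, 2], ![1, 3, 2, 1, 2], ![1, 3, 2, 2, 1],
   ![3, 1, 1, 2, 2], ![3, 1, 2, 1, 2], ![3, 1, 2, 2, 1]}

theorem monoSum_p1Terms : monoSum p1Terms = p1 := by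
  rw [monoSum, p1Terms]
  repeat rw [Finset.sum_insert (by decide)]
  simp only [Finset.sum_singleton, expMono_eq_mon, p1]
  ring

theorem monoSum_p2Terms : monoSum p2Terms = p2 := by
  rw [monoSum, p2Terms]
  repeat rw [Finset.sum_insert (by decide)]
  simp only [Finset.sum_singleton, expMono_eq_mon, p2]
  ring

/-- The exponent vector of `x_1 x_2 x_3 x_4 x_5 * x_j ^ 2 * x_i * x_k`. -/
def mulExp (j i k : Fin 5) : Fin 5 → ℕ := fun t =>
  1 + (if t = j then 2 else 0) + (if t = i then 1 else 0) + (if t = k then 1 else 0)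

theorem mulExp_comp_symm (σ : Equiv.Perm (Fin 5)) (j i k : Fin 5) :
    mulExp j i k ∘ σ.symm = mulExp (σ j) (σ i) (σ k) := by
  ext t
  simp [mulExp, Equiv.symm_apply_eq]

theorem mulExp_swap (j i k : Fin 5) : mulExp j i k = mulExp j k i := by
  ext t
  simp only [mulExp]
  omega

/-- The span of the permutations of `x_1 x_2 x_3^2 x_4^2 x_5^3` and `x_1 x_2 x_3 x_4^2 x_5^4`. -/
def orbitSpan : Submodule (ZMod 2) P5 :=
  Submodule.span (ZMod 2) {x | ∃ j i k : Fin 5, i ≠ j ∧ i ≠ k ∧ x = expMono (mulExp j i k)}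

theorem rename_mem_orbitSpan (σ : Equiv.Perm (Fin 5)) {f : P5} (hf : f ∈ orbitSpan) :
    rename σ f ∈ orbitSpan := by
  induction hf using Submodule.span_induction with
  | mem x hx =>
    obtain ⟨j, i, k, hj, hk, rfl⟩ := hx
    rw [rename_expMono, mulExp_comp_symm]
    exact Submodule.subset_span ⟨_, _, _, σ.injective.ne hj, σ.injective.ne hk, rfl⟩
  | zero => simp
  | add x y _ _ hx hy => simpa using add_mem hx hy
  | smul c x _ hx => simpa using Submodule.smul_mem _ c hx

theorem monoSum_mem_orbitSpan {P : Finset (Fin 5 → ℕ)}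
    (hP : ∀ v ∈ P, ∃ j i k, i ≠ j ∧ i ≠ k ∧ v = mulExp j i k) : monoSum P ∈ orbitSpan := by
  refine Submodule.sum_mem _ fun v hv => Submodule.subset_span ?_
  obtain ⟨j, i, k, hj, hk, rfl⟩ := hP v hv
  exact ⟨j, i, k, hj, hk, rfl⟩

theorem p1_mem_orbitSpan : p1 ∈ orbitSpan :=
  monoSum_p1Terms ▸ monoSum_mem_orbitSpan (by decide +kernel)

theorem p2_mem_orbitSpan : p2 ∈ orbitSpan :=
  monoSum_p2Terms ▸ monoSum_mem_orbitSpan (by decide +kernel)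

theorem span_rename_u4_le_orbitSpan :
    Submodule.span (ZMod 2) {x : P5 | ∃ σ : Equiv.Perm (Fin 5), x = rename (⇑σ) u4} ≤ orbitSpan := by
  refine Submodule.span_le.mpr ?_
  rintro _ ⟨σ, rfl⟩
  refine rename_mem_orbitSpan σ (Submodule.subset_span ⟨4, 2, 3, by decide, by decide, ?_⟩)
  rw [u4, ← expMono_eq_mon]
  exact congrArg expMono (by decide)

theorem monoSum_mulExp_mem_hit {i j : Fin 5} (h : i ≠ j) :
    monoSum ((Finset.univ.erase i).image (mulExp j i)) ∈ hit 9 := by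
  have key : ∀ i j : Fin 5, i ≠ j →
      ∑ t, (1 + (if t = i then 1 else 0) + if t = j then 2 else 0) < 9 ∧
      sqTerms 9 (fun t => 1 + (if t = i then 1 else 0) + if t = j then 2 else 0) =
        (Finset.univ.erase i).image (mulExp j i) := by decide +kernel
  rw [← (key i j h).2]
  exact monoSum_sqTerms_mem_hit (key i j h).1

theorem monoSum_star_mem_hit (i : Fin 5) :
    monoSum ((Finset.univ.erase i).image fun j => mulExp i j i) ∈ hit 9 := by
  have key : ∀ i : Fin 5, ∑ t, (if t = i then 4 else 1) < 9 ∧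
      sqTerms 9 (fun t => if t = i then 4 else 1) =
        (Finset.univ.erase i).image fun j => mulExp i j i := by decide +kernel
  rw [← (key i).2]
  exact monoSum_sqTerms_mem_hit (key i).1

theorem monoSum_pair_mem_hit {i j : Fin 5} (h : i ≠ j) :
    monoSum {mulExp j i j, mulExp i j i} ∈ hit 9 := by
  have hdeg : ∀ i j : Fin 5, i ≠ j → ∑ t, (if t = i ∨ t = j then 2 else 1) < 9 ∧
      ∑ t, (if t = i ∨ t = j then 1 else 2) < 9 := by decide
  have key : ∀ i j : Fin 5, i ≠ j →
      symmDiff (symmDiff (sqTerms 9 fun t => if t = i ∨ t = j then 2 else 1)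
        (sqTerms 9 fun t => if t = i ∨ t = j then 1 else 2)) (sqTerms 9 fun _ => 1) =
        {mulExp j i j, mulExp i j i} := by decide +kernel
  rw [← key i j h, ← monoSum_add_monoSum, ← monoSum_add_monoSum]
  exact add_mem (add_mem (monoSum_sqTerms_mem_hit (hdeg i j h).1)
    (monoSum_sqTerms_mem_hit (hdeg i j h).2)) (monoSum_sqTerms_mem_hit (by decide))

/-- Modulo hit polynomials, `orbitSpan` is spanned by the terms of `p1` and `p2`. -/
theorem orbitSpan_le : orbitSpan ≤
    hit 9 ⊔ Submodule.span (ZMod 2) (expMono '' ↑(p1Terms ∪ p2Terms)) := by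
  set R := hit 9 ⊔ Submodule.span (ZMod 2) (expMono '' ↑(p1Terms ∪ p2Terms)) with hR
  have hhit : hit 9 ≤ R := le_sup_left
  have hmem {v : Fin 5 → ℕ} (hv : v ∈ p1Terms ∪ p2Terms) : expMono v ∈ R :=
    le_sup_right (a := hit 9) (Submodule.subset_span ⟨v, hv, rfl⟩)
  have hpair {i j : Fin 5} (h : i ≠ j) (hm : expMono (mulExp i j i) ∈ R) :
      expMono (mulExp j i j) ∈ R := by
    refine expMono_mem_of_monoSum_mem (hhit (monoSum_pair_mem_hit h)) (by simp) fun w hw hne => ?_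
    simp only [Finset.mem_insert, Finset.mem_singleton] at hw
    rwa [hw.resolve_left hne]
  have hsq_ne : ∀ i j : Fin 5, i ≠ j → i ≠ 0 → j ≠ 0 → expMono (mulExp j i j) ∈ R := by
    have key : ∀ i j : Fin 5, i ≠ j → i ≠ 0 → j ≠ 0 →
        mulExp j i j ∈ p1Terms ∪ p2Terms ∨ mulExp i j i ∈ p1Terms ∪ p2Terms := by decide +kernel
    intro i j hij hi hj
    rcases key i j hij hi hj with h | h
    · exact hmem h
    · exact hpair hij (hmem h)
  have hsq_zero (i : Fin 5) (hi : i ≠ 0) : expMono (mulExp i 0 i) ∈ R := by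
    refine expMono_mem_of_monoSum_mem (hhit (monoSum_star_mem_hit i))
      (Finset.mem_image_of_mem _ (by simp [hi.symm])) fun w hw hne => ?_
    obtain ⟨j, hj, rfl⟩ := Finset.mem_image.mp hw
    exact hsq_ne j i (Finset.ne_of_mem_erase hj) (fun h => hne (by rw [h])) hi
  have hsq (i j : Fin 5) (hij : i ≠ j) : expMono (mulExp j i j) ∈ R := by
    by_cases hi : i = 0
    · subst hi; exact hsq_zero j hij.symm
    by_cases hj : j = 0
    · subst hj; exact hpair hij (hsq_zero i hij)
    exact hsq_ne i j hij hi hj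
  have hbase (j k : Fin 5) (hkj : k ≠ j) (hk : k ≠ if j = 0 then 1 else 0) :
      expMono (mulExp j k (if j = 0 then 1 else 0)) ∈ R := by
    have key : ∀ j k : Fin 5, k ≠ j → (k ≠ if j = 0 then 1 else 0) → ∀ l, l ≠ k →
        (l = if j = 0 then 1 else 0) ∨ l = j ∨ mulExp j k l ∈ p1Terms ∪ p2Terms := by
      decide +kernel
    refine expMono_mem_of_monoSum_mem (hhit (monoSum_mulExp_mem_hit hkj))
      (Finset.mem_image_of_mem _ (by simp [hk.symm])) fun w hw hne => ?_
    obtain ⟨l, hl, rfl⟩ := Finset.mem_image.mp hw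
    rcases key j k hkj hk l (Finset.ne_of_mem_erase hl) with rfl | rfl | h
    · exact absurd rfl hne
    · exact hsq k l hkj
    · exact hmem h
  refine Submodule.span_le.mpr ?_
  rintro _ ⟨j, i, k, hij, hik, rfl⟩
  have key : ∀ j i k : Fin 5, i ≠ j → i ≠ k → k = j ∨ mulExp j i k ∈ p1Terms ∪ p2Terms ∨
      (i = if j = 0 then 1 else 0) ∨ k = if j = 0 then 1 else 0 := by decide +kernel
  by_cases hkj : k = j
  · subst hkj; exact hsq i k hik
  rcases key j i k hij hik with h | h | rfl | rfl
  · exact absurd h hkj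
  · exact hmem h
  · rw [mulExp_swap]; exact hbase j k hkj hik.symm
  · exact hbase j i hij hik

/-- The support of a functional killing the hit polynomials, dual to `x_1^3 x_2 x_3 x_4^2 x_5^2`. -/
def cubeTerms : Finset (Fin 5 → ℕ) :=
  {![3, 2, 2, 1, 1], ![3, 2, 1, 2, 1], ![3, 1, 2, 2, 1], ![5, 1, 1, 1, 1]}

/-- The support of a functional killing the hit polynomials, symmetric in `x_1, x_2, x_3`. -/
def quarticTerms : Finset (Fin 5 → ℕ) :=
  {![3, 2, 2, 1, 1], ![2, 3, 2, 1, 1], ![2, 2, 3, 1, 1],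
   ![5, 1, 1, 1, 1], ![1, 5, 1, 1, 1], ![1, 1, 5, 1, 1],
   ![4, 2, 1, 1, 1], ![4, 1, 2, 1, 1], ![2, 4, 1, 1, 1],
   ![1, 4, 2, 1, 1], ![2, 1, 4, 1, 1], ![1, 2, 4, 1, 1]}

/-- For exponent vectors of degree nine without zero entries, `coeffSum_hit` needs only finitely
many total squares. -/
theorem coeffSum_hit_nine {S : Finset (Fin 5 → ℕ)} (hS : ∀ b ∈ S, ∑ i, b i = 9)
    (hpos : ∀ b ∈ S, ∀ i, 1 ≤ b i)
    (h : ∀ e : Fin 5 → Fin 4, ∑ i, (e i : ℕ) < 4 →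
      Even (∑ b ∈ S, sqCoeff (fun i => 1 + (e i : ℕ)) b)) {f : P5} (hf : f ∈ hit 9) :
    coeffSum S f = 0 := by
  refine coeffSum_hit hS (fun a ha => ?_) hf
  by_cases h0 : ∃ i, a i = 0
  · obtain ⟨i, hi⟩ := h0
    rw [Finset.sum_eq_zero]
    · exact Even.zero
    intro b hb
    refine Finset.prod_eq_zero (Finset.mem_univ i) ?_
    obtain ⟨n, hn⟩ := Nat.exists_eq_add_of_le' (hpos b hb i)
    simp [sqPowCoeff, hi, hn]
  · push Not at h0
    rw [Fin.sum_univ_five] at ha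
    have hpos' (i : Fin 5) : 1 ≤ a i := Nat.one_le_iff_ne_zero.mpr (h0 i)
    have h1 := hpos' 0
    have h2 := hpos' 1
    have h3 := hpos' 2
    have h4 := hpos' 3
    have h5 := hpos' 4
    have hlt : ∀ i, a i - 1 < 4 := by
      intro i
      fin_cases i <;> simp <;> omega
    have := h (fun i => ⟨a i - 1, hlt i⟩) (by simp only [Fin.sum_univ_five]; omega)
    simpa only [Nat.add_sub_cancel' (hpos' _)] using this

theorem coeffSum_cubeTerms_hit {f : P5} (hf : f ∈ hit 9) : coeffSum cubeTerms f = 0 :=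
  coeffSum_hit_nine (by decide) (by decide) (by decide +kernel) hf

theorem coeffSum_quarticTerms_hit {f : P5} (hf : f ∈ hit 9) : coeffSum quarticTerms f = 0 :=
  coeffSum_hit_nine (by decide) (by decide) (by decide +kernel) hf

theorem coeffSum_cubeTerms_rename_p1 (σ : Equiv.Perm (Fin 5)) :
    coeffSum cubeTerms (rename σ p1) = 0 := by
  rw [← monoSum_p1Terms, coeffSum_rename_monoSum, ZMod.natCast_eq_zero_iff_even]
  revert σ
  decide +kernel

theorem coeffSum_quarticTerms_rename_p1 (σ : Equiv.Perm (Fin 5)) :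
    coeffSum quarticTerms (rename σ p1) = 1 := by
  rw [← monoSum_p1Terms, coeffSum_rename_monoSum, ZMod.natCast_eq_one_iff_odd]
  revert σ
  decide +kernel

theorem coeffSum_cubeTerms_rename_p2 (σ : Equiv.Perm (Fin 5)) :
    coeffSum cubeTerms (rename σ p2) = 1 := by
  rw [← monoSum_p2Terms, coeffSum_rename_monoSum, ZMod.natCast_eq_one_iff_odd]
  revert σ
  decide +kernel

theorem coeffSum_quarticTerms_rename_p2 (σ : Equiv.Perm (Fin 5)) :
    coeffSum quarticTerms (rename σ p2) = 0 := by
  rw [← monoSum_p2Terms, coeffSum_rename_monoSum, ZMod.natCast_eq_zero_iff_even]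
  revert σ
  decide +kernel

theorem mem_hit_of_coeffSum_rename_eq_zero {f : P5} (hf : f ∈ orbitSpan)
    (hcube : ∀ σ : Equiv.Perm (Fin 5), coeffSum cubeTerms (rename σ f) = 0)
    (hquartic : ∀ σ : Equiv.Perm (Fin 5), coeffSum quarticTerms (rename σ f) = 0) :
    f ∈ hit 9 := by
  obtain ⟨h, hh, y, hy, rfl⟩ := Submodule.mem_sup.mp (orbitSpan_le hf)
  obtain ⟨c, rfl⟩ := Submodule.mem_span_image_finset_iff_exists_fun' (ZMod 2) |>.mp hy
  have value (S : Finset (Fin 5 → ℕ)) (hS : ∀ {f : P5}, f ∈ hit 9 → coeffSum S f = 0)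
      (σ : Equiv.Perm (Fin 5)) :
      coeffSum S (rename σ (h + ∑ v ∈ p1Terms ∪ p2Terms, c v • expMono v)) =
        ∑ v ∈ p1Terms ∪ p2Terms, if v ∘ σ.symm ∈ S then c v else 0 := by
    simp [hS (rename_mem_hit σ hh), rename_expMono, coeffSum_expMono]
  have dual_cube : ∀ v ∈ p2Terms \ p1Terms, ∃ σ : Equiv.Perm (Fin 5),
      ∀ w ∈ p1Terms ∪ p2Terms, w ∘ σ.symm ∈ cubeTerms ↔ w = v := by decide +kernel
  have dual_quartic : ∀ v ∈ p1Terms, ∃ σ : Equiv.Perm (Fin 5),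
      ∀ w ∈ p1Terms, w ∘ σ.symm ∈ quarticTerms ↔ w = v := by decide +kernel
  have c_cube (v) (hv : v ∈ p2Terms \ p1Terms) : c v = 0 := by
    obtain ⟨σ, hσ⟩ := dual_cube v hv
    have hv' : v ∈ p1Terms ∪ p2Terms := Finset.mem_union_right _ (Finset.mem_sdiff.mp hv).1
    rw [← hcube σ, value _ coeffSum_cubeTerms_hit, Finset.sum_eq_single_of_mem v hv'
      fun w hw hne => if_neg (mt (hσ w hw).mp hne), if_pos ((hσ v hv').mpr rfl)]
  have c_quartic (v) (hv : v ∈ p1Terms) : c v = 0 := by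
    obtain ⟨σ, hσ⟩ := dual_quartic v hv
    rw [← hquartic σ, value _ coeffSum_quarticTerms_hit,
      Finset.sum_eq_single_of_mem v (Finset.mem_union_left _ hv), if_pos ((hσ v hv).mpr rfl)]
    intro w hw hne
    by_cases hw1 : w ∈ p1Terms
    · exact if_neg (mt (hσ w hw1).mp hne)
    · rw [c_cube w (by simp_all), ite_self]
  rw [Finset.sum_eq_zero, add_zero]
  · exact hh
  intro v hv
  by_cases hv1 : v ∈ p1Terms
  · rw [c_quartic v hv1, zero_smul]
  · rw [c_cube v (by simp_all), zero_smul]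

/-- A functional killing the hit polynomials is invariant on classes that are invariant. -/
theorem coeffSum_rename_eq {S : Finset (Fin 5 → ℕ)}
    (hS : ∀ {f : P5}, f ∈ hit 9 → coeffSum S f = 0) {f : P5} {σ : Equiv.Perm (Fin 5)}
    (h : IsHit 9 (rename σ f - f)) : coeffSum S (rename σ f) = coeffSum S f := by
  rw [← sub_eq_zero, ← map_sub]
  exact hS h

theorem rename_sub_mem_hit_of_eq_p1_p2 {p : P5} (a b : ZMod 2) (hp : p = a • p1 + b • p2)
    (σ : Equiv.Perm (Fin 5)) : rename σ p - p ∈ hit 9 := by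
  have hmem : p ∈ orbitSpan := hp ▸
    add_mem (Submodule.smul_mem _ a p1_mem_orbitSpan) (Submodule.smul_mem _ b p2_mem_orbitSpan)
  have hcube (τ : Equiv.Perm (Fin 5)) : coeffSum cubeTerms (rename τ p) = b := by
    simp [hp, coeffSum_cubeTerms_rename_p1, coeffSum_cubeTerms_rename_p2]
  have hquartic (τ : Equiv.Perm (Fin 5)) : coeffSum quarticTerms (rename τ p) = a := by
    simp [hp, coeffSum_quarticTerms_rename_p1, coeffSum_quarticTerms_rename_p2]
  have hcomp (τ : Equiv.Perm (Fin 5)) : rename τ (rename σ p) = rename ⇑(τ * σ) p := by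
    rw [rename_rename, Equiv.Perm.coe_mul]
  refine mem_hit_of_coeffSum_rename_eq_zero (sub_mem (rename_mem_orbitSpan σ hmem) hmem)
    (fun τ => ?_) fun τ => ?_
  · rw [map_sub, map_sub, hcomp, hcube, hcube, sub_self]
  · rw [map_sub, map_sub, hcomp, hquartic, hquartic, sub_self]

theorem exists_sub_mem_hit {f : P5} (hf : f ∈ orbitSpan)
    (h : ∀ σ : Equiv.Perm (Fin 5), IsHit 9 (rename (⇑σ) f - f)) :
    ∃ a b : ZMod 2, f - (a • p1 + b • p2) ∈ hit 9 := by
  refine ⟨coeffSum quarticTerms f, coeffSum cubeTerms f, mem_hit_of_coeffSum_rename_eq_zero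
    (sub_mem hf (add_mem (Submodule.smul_mem _ _ p1_mem_orbitSpan)
      (Submodule.smul_mem _ _ p2_mem_orbitSpan))) (fun τ => ?_) fun τ => ?_⟩
  · simp [coeffSum_cubeTerms_rename_p1, coeffSum_cubeTerms_rename_p2,
      coeffSum_rename_eq coeffSum_cubeTerms_hit (h τ)]
  · simp [coeffSum_quarticTerms_rename_p1, coeffSum_quarticTerms_rename_p2,
      coeffSum_rename_eq coeffSum_quarticTerms_hit (h τ)]

theorem isHit_rename_sub {f : P5} {a b : ZMod 2} (hf : f - (a • p1 + b • p2) ∈ hit 9)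
    (σ : Equiv.Perm (Fin 5)) : IsHit 9 (rename (⇑σ) f - f) := by
  have := add_mem (sub_mem (rename_mem_hit σ hf) hf)
    (rename_sub_mem_hit_of_eq_p1_p2 a b rfl σ)
  rw [map_sub] at this
  rw [← mem_hit]
  convert this using 1
  abel

/-- (i) An element of the span of the permutations of `u_4` is Σ_5-invariant modulo hit
polynomials iff it is congruent modulo hit polynomials to one of `0, p_1, p_2, p_1 + p_2`;
(ii) the classes of `p_1, p_2` in `(QP_5)_9` are linearly independent. -/
theorem stmt18 :
    (∀ f : P5,
      f ∈ Submodule.span (ZMod 2) {x : P5 | ∃ σ : Equiv.Perm (Fin 5), x = rename (⇑σ) u4} →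
      ((∀ σ : Equiv.Perm (Fin 5), IsHit 9 (rename (⇑σ) f - f)) ↔
        (IsHit 9 f ∨ IsHit 9 (f - p1) ∨ IsHit 9 (f - p2) ∨ IsHit 9 (f - (p1 + p2))))) ∧
    (∀ a b : ZMod 2, IsHit 9 (a • p1 + b • p2) → a = 0 ∧ b = 0) := by
  refine ⟨fun f hf => ⟨fun h => ?_, ?_⟩, fun a b h => ?_⟩
  · obtain ⟨a, b, hab⟩ := exists_sub_mem_hit (span_rename_u4_le_orbitSpan hf) h
    rw [mem_hit] at hab
    have hZ : ∀ c : ZMod 2, c = 0 ∨ c = 1 := by decide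
    rcases hZ a with rfl | rfl <;> rcases hZ b with rfl | rfl <;>
      simp only [zero_smul, one_smul, zero_add, add_zero, sub_zero] at hab
    · exact Or.inl hab
    · exact Or.inr (Or.inr (Or.inl hab))
    · exact Or.inr (Or.inl hab)
    · exact Or.inr (Or.inr (Or.inr hab))
  · rintro (h | h | h | h)
    · exact isHit_rename_sub (a := 0) (b := 0) (by simpa [mem_hit] using h)
    · exact isHit_rename_sub (a := 1) (b := 0) (by simpa [mem_hit] using h)
    · exact isHit_rename_sub (a := 0) (b := 1) (by simpa [mem_hit] using h)
    · exact isHit_rename_sub (a := 1) (b := 1) (by simpa [mem_hit] using h)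
  · have hquartic := coeffSum_quarticTerms_hit (rename_mem_hit 1 h)
    have hcube := coeffSum_cubeTerms_hit (rename_mem_hit 1 h)
    rw [map_add, map_add, map_smul, map_smul, map_smul, map_smul] at hquartic hcube
    rw [coeffSum_quarticTerms_rename_p1, coeffSum_quarticTerms_rename_p2] at hquartic
    rw [coeffSum_cubeTerms_rename_p1, coeffSum_cubeTerms_rename_p2] at hcube
    exact ⟨by simpa using hquartic, by simpa using hcube⟩
end
end

section
/- If f is an F_2-linear combination of the monomials σ·(x_1^3x_2^3x_3^5x_4^6x_5^6), where σ ranges over all permutations of the variables x_1,...,x_5, and if for every permutation σ the polynomial σ·f − f is the sum of a hit polynomial and an element of P_5^−((3,4,3)), then f itself is the sum of a hit polynomial and an element of P_5^−((3,4,3)). -/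
open MvPolynomial

noncomputable section

/-- The hit polynomials of degree `n`, as a submodule. -/
def hitSub (n : ℕ) : Submodule (ZMod 2) P5 :=
  (⨅ m : {m : ℕ // n ≤ m},
    LinearMap.ker (homogeneousComponent (R := ZMod 2) (σ := Fin 5) m.1)).map
    (homogeneousComponent n ∘ₗ Sq.toLinearMap)

theorem mem_hitSub {n : ℕ} {f : P5} : f ∈ hitSub n ↔ IsHit n f := by
  simp only [hitSub, IsHit, Submodule.mem_map, Submodule.mem_iInf, LinearMap.mem_ker,
    Subtype.forall, LinearMap.comp_apply, AlgHom.toLinearMap_apply, eq_comm (a := f)]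

/-- Polynomials which are the sum of a hit polynomial and an element of `P_5^-(w)`. -/
def hitMod (n : ℕ) (w : List ℕ) : Submodule (ZMod 2) P5 := hitSub n ⊔ PMinus n w

theorem mem_hitMod {n : ℕ} {w : List ℕ} {f : P5} :
    f ∈ hitMod n w ↔ ∃ h p : P5, IsHit n h ∧ p ∈ PMinus n w ∧ f = h + p := by
  simp only [hitMod, Submodule.mem_sup, mem_hitSub]
  constructor
  · rintro ⟨h, hh, p, hp, rfl⟩
    exact ⟨h, p, hh, hp, rfl⟩
  · rintro ⟨h, p, hh, hp, rfl⟩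
    exact ⟨h, hh, p, hp, rfl⟩

theorem rename_Sq (σ : Equiv.Perm (Fin 5)) (g : P5) : rename σ (Sq g) = Sq (rename σ g) := by
  have h : (rename σ).comp Sq = Sq.comp (rename (R := ZMod 2) σ) := by
    ext i
    simp [Sq]
  exact DFunLike.congr_fun h g

theorem IsHit.rename {n : ℕ} {f : P5} (hf : IsHit n f) (σ : Equiv.Perm (Fin 5)) :
    IsHit n (rename σ f) := by
  obtain ⟨g, hg, rfl⟩ := hf
  refine ⟨MvPolynomial.rename σ g, fun m hm => ?_, ?_⟩
  · rw [← rename_homogeneousComponent, hg m hm, map_zero]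
  · rw [rename_homogeneousComponent, rename_Sq]

theorem wt_mapDomain (σ : Equiv.Perm (Fin 5)) (d : Fin 5 →₀ ℕ) (i : ℕ) :
    wt (d.mapDomain σ) i = wt d i := by
  unfold wt
  refine (Finset.card_equiv σ fun j => ?_).symm
  simp

theorem rename_mem_PMinus {n : ℕ} {w : List ℕ} {p : P5} (hp : p ∈ PMinus n w)
    (σ : Equiv.Perm (Fin 5)) : rename σ p ∈ PMinus n w := by
  have : PMinus n w ≤ (PMinus n w).comap (rename σ : P5 →ₐ[ZMod 2] P5).toLinearMap := by
    refine Submodule.span_le.2 ?_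
    rintro _ ⟨d, rfl, hd, hw⟩
    refine Submodule.subset_span ⟨d.mapDomain σ, by simp [rename_monomial], ?_, ?_⟩
    · rw [← hd, ← Equiv.sum_comp σ]
      simp [Finsupp.mapDomain_apply σ.injective]
    · simpa [wtLt, wt_mapDomain] using hw
  exact this hp

theorem rename_mem_hitMod {n : ℕ} {w : List ℕ} {f : P5} (hf : f ∈ hitMod n w)
    (σ : Equiv.Perm (Fin 5)) : rename σ f ∈ hitMod n w := by
  obtain ⟨h, p, hh, hp, rfl⟩ := mem_hitMod.1 hf
  exact mem_hitMod.2 ⟨_, _, hh.rename σ, rename_mem_PMinus hp σ, map_add _ _ _⟩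

/-- The monomial with exponent vector `a`. -/
def xpow (a : Fin 5 → ℕ) : P5 := ∏ i, X i ^ a i

theorem mon_eq_xpow (a b c d e : ℕ) : mon a b c d e = xpow ![a, b, c, d, e] := by
  simp [mon, xpow, Fin.prod_univ_five]

theorem xpow_eq_monomial (a : Fin 5 → ℕ) :
    xpow a = monomial (Finsupp.equivFunOnFinite.symm a) 1 := by
  rw [monomial_eq, Finsupp.prod_fintype _ _ (by simp)]
  simp [xpow]

theorem rename_xpow (σ : Equiv.Perm (Fin 5)) (a : Fin 5 → ℕ) :
    rename σ (xpow a) = xpow (a ∘ σ.symm) := by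
  simp only [xpow, map_prod, map_pow, rename_X]
  rw [← Equiv.prod_comp σ (fun i => X i ^ (a ∘ σ.symm) i)]
  simp

theorem homogeneousComponent_xpow (n : ℕ) (a : Fin 5 → ℕ) :
    homogeneousComponent n (xpow a) = if ∑ i, a i = n then xpow a else 0 := by
  have h : (xpow a) ∈ homogeneousSubmodule (Fin 5) (ZMod 2) (∑ i, a i) :=
    IsHomogeneous.prod _ _ _ fun i _ => isHomogeneous_X_pow i (a i)
  rw [homogeneousComponent_of_mem h]
  simp only [eq_comm]

theorem Sq_xpow (a : Fin 5 → ℕ) :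
    Sq (xpow a) = ∑ t ∈ Fintype.piFinset fun i => Finset.range (a i + 1),
      (∏ i, ((a i).choose (t i) : ZMod 2)) • xpow (a + t) := by
  have h : ∀ i, Sq (X i) ^ a i = ∑ k ∈ Finset.range (a i + 1),
      ((a i).choose k : ZMod 2) • (X i ^ (a i + k) : P5) := by
    intro i
    have : (Sq (X i) : P5) = X i * (X i + 1) := by simp [Sq]; ring
    rw [this, mul_pow, add_pow, Finset.mul_sum]
    refine Finset.sum_congr rfl fun k _ => ?_
    simp [smul_eq_C_mul, pow_add]
    ring
  simp only [xpow, map_prod, map_pow, h, Finset.prod_univ_sum, Finset.prod_smul, Pi.add_apply]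

theorem homogeneousComponent_Sq_xpow (a : Fin 5 → ℕ) (k : ℕ) :
    homogeneousComponent (∑ i, a i + k) (Sq (xpow a)) =
      ∑ t ∈ Finset.Nat.antidiagonalTuple 5 k,
        (∏ i, ((a i).choose (t i) : ZMod 2)) • xpow (a + t) := by
  simp only [Sq_xpow, map_sum, map_smul, homogeneousComponent_xpow, Pi.add_apply,
    Finset.sum_add_distrib, add_right_inj, smul_ite, smul_zero]
  rw [← Finset.sum_filter]
  refine Finset.sum_subset (fun t ht => ?_) fun t ht ht' => ?_
  · simpa [Finset.Nat.mem_antidiagonalTuple] using (Finset.mem_filter.1 ht).2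
  · have hk := Finset.Nat.mem_antidiagonalTuple.1 ht
    have : ∃ i, a i < t i := by
      by_contra! h
      exact ht' (by simp [hk, h])
    obtain ⟨i, hi⟩ := this
    rw [Finset.prod_eq_zero (Finset.mem_univ i) (by simp [Nat.choose_eq_zero_of_lt hi]), zero_smul]

theorem xpow_mem_PMinus {n : ℕ} {w : List ℕ} {a : Fin 5 → ℕ} (hn : ∑ i, a i = n)
    (h : wtLt (Finsupp.equivFunOnFinite.symm a) w) : xpow a ∈ PMinus n w :=
  Submodule.subset_span ⟨_, xpow_eq_monomial a, hn, h⟩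

/-- Applying `Sq^k` to the monomial `x^a`, only the terms indexed by `L` matter modulo
`P_5^-(3,4,3)`. -/
theorem sum_xpow_mem_hitMod (a : Fin 5 → ℕ) (k : ℕ) (hk : 0 < k)
    (L : Finset (Fin 5 → ℕ)) (hL : L ⊆ Finset.Nat.antidiagonalTuple 5 k)
    (hodd : ∀ t ∈ L, ∏ i, (a i).choose (t i) % 2 = 1)
    (hlow : ∀ t ∈ Finset.Nat.antidiagonalTuple 5 k, t ∈ L ∨ ∏ i, (a i).choose (t i) % 2 = 0 ∨
      ∃ i < 3,
        (∀ j < i, (Finset.univ.filter fun l : Fin 5 => Nat.testBit (a l + t l) j).card =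
          [3, 4, 3].getD j 0) ∧
        (Finset.univ.filter fun l : Fin 5 => Nat.testBit (a l + t l) i).card <
          [3, 4, 3].getD i 0) :
    ∑ t ∈ L, xpow (a + t) ∈ hitMod (∑ i, a i + k) [3, 4, 3] := by
  have hcoe : ∀ t : Fin 5 → ℕ, (∏ i, ((a i).choose (t i) : ZMod 2)) =
      ((∏ i, (a i).choose (t i) % 2 : ℕ) : ZMod 2) := fun t => by simp
  have hhit : homogeneousComponent (∑ i, a i + k) (Sq (xpow a)) ∈
      hitMod (∑ i, a i + k) [3, 4, 3] := by
    refine Submodule.mem_sup_left (mem_hitSub.2 ⟨xpow a, fun m hm => ?_, rfl⟩)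
    rw [homogeneousComponent_xpow, if_neg (by omega)]
  rw [homogeneousComponent_Sq_xpow, ← Finset.sum_sdiff hL] at hhit
  rw [Submodule.add_mem_iff_right] at hhit
  · convert hhit using 1
    refine Finset.sum_congr rfl fun t ht => ?_
    rw [hcoe, hodd t ht, Nat.cast_one, one_smul]
  · refine Submodule.sum_mem _ fun t ht => ?_
    obtain ⟨ht, htL⟩ := Finset.mem_sdiff.1 ht
    rcases hlow t ht with h | h | ⟨i, -, h⟩
    · exact absurd h htL
    · rw [hcoe, h]
      simp
    · refine Submodule.smul_mem _ _ (Submodule.mem_sup_right (xpow_mem_PMinus ?_ ⟨i, h⟩))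
      simp [Finset.sum_add_distrib, Finset.Nat.mem_antidiagonalTuple.1 ht]

theorem swap_relation :
    xpow ![3, 3, 6, 5, 6] + xpow ![3, 3, 5, 6, 6] ∈ hitMod 23 [3, 4, 3] := by
  have h := sum_xpow_mem_hitMod ![3, 3, 5, 5, 6] 1 one_pos {![0, 0, 1, 0, 0], ![0, 0, 0, 1, 0]}
    (by decide) (by decide) (by decide)
  rw [Finset.sum_pair (by decide)] at h
  simpa [Fin.sum_univ_five] using h

theorem triangle_relation :
    xpow ![5, 3, 3, 6, 6] + (xpow ![3, 5, 3, 6, 6] + xpow ![3, 3, 5, 6, 6]) ∈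
      hitMod 23 [3, 4, 3] := by
  have h := sum_xpow_mem_hitMod ![3, 3, 3, 6, 6] 2 two_pos
    {![2, 0, 0, 0, 0], ![0, 2, 0, 0, 0], ![0, 0, 2, 0, 0]} (by decide) (by decide) (by decide)
  rw [Finset.sum_insert (by decide), Finset.sum_pair (by decide)] at h
  simpa [Fin.sum_univ_five] using h

/-- The class of `x^a` modulo hit polynomials and `P_5^-(3,4,3)`. -/
def xcls (a : Fin 5 → ℕ) : P5 ⧸ hitMod 23 [3, 4, 3] := Submodule.Quotient.mk (xpow a)

theorem add_self_quotient (x : P5 ⧸ hitMod 23 [3, 4, 3]) : x + x = 0 := by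
  rw [← two_nsmul, ← Nat.cast_smul_eq_nsmul (ZMod 2), show ((2 : ℕ) : ZMod 2) = 0 from rfl,
    zero_smul]

theorem xcls_swap {a b : Fin 5 → ℕ} (hab : ∃ σ : Equiv.Perm (Fin 5),
    a ∘ σ = ![3, 3, 6, 5, 6] ∧ b ∘ σ = ![3, 3, 5, 6, 6]) : xcls a = xcls b := by
  obtain ⟨σ, ha, hb⟩ := hab
  have h := rename_mem_hitMod swap_relation σ
  rw [← ha, ← hb, map_add, rename_xpow, rename_xpow, Function.comp_assoc, Function.comp_assoc,
    Equiv.self_comp_symm, Function.comp_id, Function.comp_id] at h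
  have h' : xcls a + xcls b = 0 := (Submodule.Quotient.mk_eq_zero _).2 h
  exact add_right_cancel (h'.trans (add_self_quotient _).symm)

theorem xcls_triangle {a b c : Fin 5 → ℕ} (habc : ∃ σ : Equiv.Perm (Fin 5),
    a ∘ σ = ![5, 3, 3, 6, 6] ∧ b ∘ σ = ![3, 5, 3, 6, 6] ∧ c ∘ σ = ![3, 3, 5, 6, 6]) :
    xcls a + (xcls b + xcls c) = 0 := by
  obtain ⟨σ, ha, hb, hc⟩ := habc
  have h := rename_mem_hitMod triangle_relation σ
  simp only [← ha, ← hb, ← hc, map_add, rename_xpow, Function.comp_assoc,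
    Equiv.self_comp_symm, Function.comp_id] at h
  exact (Submodule.Quotient.mk_eq_zero _).2 h

open Equiv in
/-- The fifteen double transpositions in `Σ_5`. -/
def doubleTranspositionList : List (Perm (Fin 5)) :=
  [swap 0 1 * swap 2 3, swap 0 1 * swap 2 4, swap 0 1 * swap 3 4,
    swap 0 2 * swap 1 3, swap 0 2 * swap 1 4, swap 0 2 * swap 3 4,
    swap 0 3 * swap 1 2, swap 0 3 * swap 1 4, swap 0 3 * swap 2 4,
    swap 0 4 * swap 1 2, swap 0 4 * swap 1 3, swap 0 4 * swap 2 3,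
    swap 1 2 * swap 3 4, swap 1 3 * swap 2 4, swap 1 4 * swap 2 3]

/-- The conjugacy class of double transpositions in `Σ_5`. -/
def doubleTranspositions : Finset (Equiv.Perm (Fin 5)) :=
  Finset.univ.filter fun τ => τ ≠ 1 ∧ τ * τ = 1 ∧ Equiv.Perm.sign τ = 1

theorem doubleTranspositions_eq : doubleTranspositions = doubleTranspositionList.toFinset := by
  decide +kernel

theorem doubleTranspositionList_nodup : doubleTranspositionList.Nodup := by
  decide +kernel

theorem card_doubleTranspositions : doubleTranspositions.card = 15 := by
  rw [doubleTranspositions_eq, List.toFinset_card_of_nodup doubleTranspositionList_nodup]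
  rfl

theorem sum_doubleTranspositions_mul {M : Type*} [AddCommMonoid M] (σ : Equiv.Perm (Fin 5))
    (F : Equiv.Perm (Fin 5) → M) :
    ∑ τ ∈ doubleTranspositions, F (τ * σ) = ∑ τ ∈ doubleTranspositions, F (σ * τ) := by
  refine (Finset.sum_equiv (MulAut.conj σ).toEquiv (fun τ => ?_) fun τ _ => ?_).symm
  · have h : σ * τ * σ⁻¹ * (σ * τ * σ⁻¹) = σ * (τ * τ) * σ⁻¹ := by group
    simp [doubleTranspositions, h, conj_eq_one_iff, mul_right_comm]
  · simp

theorem sum_rename_doubleTranspositions_mem :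
    ∑ τ ∈ doubleTranspositions, rename τ (xpow ![3, 3, 5, 6, 6]) ∈ hitMod 23 [3, 4, 3] := by
  rw [← Submodule.Quotient.mk_eq_zero, doubleTranspositions_eq,
    List.sum_toFinset _ doubleTranspositionList_nodup]
  have e : ∀ (τ : Equiv.Perm (Fin 5)) (a : Fin 5 → ℕ), ![3, 3, 5, 6, 6] ∘ τ.symm = a →
      (Submodule.Quotient.mk (rename τ (xpow ![3, 3, 5, 6, 6])) : P5 ⧸ hitMod 23 [3, 4, 3]) =
        xcls a := by
    rintro τ _ rfl
    rw [rename_xpow, xcls]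
  simp only [doubleTranspositionList, List.map_cons, List.map_nil, List.sum_cons, List.sum_nil,
    Submodule.Quotient.mk_add, Submodule.Quotient.mk_zero]
  rw [e _ ![3, 3, 6, 5, 6] (by decide),
    e _ ![3, 3, 6, 6, 5] (by decide),
    e _ ![3, 3, 5, 6, 6] (by decide),
    e _ ![5, 6, 3, 3, 6] (by decide),
    e _ ![5, 6, 3, 6, 3] (by decide),
    e _ ![5, 3, 3, 6, 6] (by decide),
    e _ ![6, 5, 3, 3, 6] (by decide),
    e _ ![6, 6, 5, 3, 3] (by decide),
    e _ ![6, 3, 6, 3, 5] (by decide),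
    e _ ![6, 5, 3, 6, 3] (by decide),
    e _ ![6, 6, 5, 3, 3] (by decide),
    e _ ![6, 3, 6, 5, 3] (by decide),
    e _ ![3, 5, 3, 6, 6] (by decide),
    e _ ![3, 6, 6, 3, 5] (by decide),
    e _ ![3, 6, 6, 5, 3] (by decide)]
  rw [xcls_swap (a := ![3, 3, 6, 5, 6]) (b := ![3, 3, 5, 6, 6]) (by decide +kernel),
    xcls_swap (a := ![3, 3, 6, 6, 5]) (b := ![3, 3, 5, 6, 6]) (by decide +kernel),
    xcls_swap (a := ![6, 5, 3, 3, 6]) (b := ![5, 6, 3, 3, 6]) (by decide +kernel),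
    xcls_swap (a := ![6, 6, 5, 3, 3]) (b := ![5, 6, 6, 3, 3]) (by decide +kernel),
    xcls_swap (a := ![6, 3, 6, 3, 5]) (b := ![5, 3, 6, 3, 6]) (by decide +kernel),
    xcls_swap (a := ![6, 5, 3, 6, 3]) (b := ![5, 6, 3, 6, 3]) (by decide +kernel),
    xcls_swap (a := ![6, 3, 6, 5, 3]) (b := ![5, 3, 6, 6, 3]) (by decide +kernel),
    xcls_swap (a := ![3, 6, 6, 3, 5]) (b := ![3, 5, 6, 3, 6]) (by decide +kernel),
    xcls_swap (a := ![3, 6, 6, 5, 3]) (b := ![3, 5, 6, 6, 3]) (by decide +kernel)]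
  have t2 := xcls_triangle (a := ![5, 3, 3, 6, 6]) (b := ![3, 5, 3, 6, 6])
    (c := ![3, 3, 5, 6, 6]) (by decide +kernel)
  have t3 := xcls_triangle (a := ![5, 3, 6, 3, 6]) (b := ![3, 5, 6, 3, 6])
    (c := ![3, 3, 6, 5, 6]) (by decide +kernel)
  rw [xcls_swap (a := ![3, 3, 6, 5, 6]) (b := ![3, 3, 5, 6, 6]) (by decide +kernel)] at t3
  have t4 := xcls_triangle (a := ![5, 3, 6, 6, 3]) (b := ![3, 5, 6, 6, 3])
    (c := ![3, 3, 6, 6, 5]) (by decide +kernel)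
  rw [xcls_swap (a := ![3, 3, 6, 6, 5]) (b := ![3, 3, 5, 6, 6]) (by decide +kernel)] at t4
  linear_combination (norm := module) t2 + t3 + t4 +
    add_self_quotient (xcls ![5, 6, 3, 3, 6]) +
    add_self_quotient (xcls ![5, 6, 3, 6, 3]) +
    add_self_quotient (xcls ![5, 6, 6, 3, 3])

theorem sum_rename_doubleTranspositions_mem_of_mem_span {f : P5}
    (hf : f ∈ Submodule.span (ZMod 2)
      {x : P5 | ∃ σ : Equiv.Perm (Fin 5), x = rename (⇑σ) (mon 3 3 5 6 6)}) :
    ∑ τ ∈ doubleTranspositions, rename τ f ∈ hitMod 23 [3, 4, 3] := by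
  induction hf using Submodule.span_induction with
  | mem x hx =>
    obtain ⟨σ, rfl⟩ := hx
    have h : ∀ α β : Equiv.Perm (Fin 5), rename α (rename β (mon 3 3 5 6 6)) =
        rename (⇑(α * β)) (mon 3 3 5 6 6) := fun α β => by
      rw [rename_rename, Equiv.Perm.coe_mul]
    simp only [h]
    rw [sum_doubleTranspositions_mul σ (fun τ => rename (⇑τ) (mon 3 3 5 6 6))]
    simp only [← h]
    rw [← map_sum, mon_eq_xpow]
    exact rename_mem_hitMod sum_rename_doubleTranspositions_mem σ
  | zero => simp
  | add x y _ _ hx hy => simpa [Finset.sum_add_distrib] using add_mem hx hy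
  | smul c x _ hx => simpa [← Finset.smul_sum] using Submodule.smul_mem _ c hx

/-- Σ_5-invariance modulo hit + P_5^-((3,4,3)) forces triviality on the span of the
permutations of x_1^3 x_2^3 x_3^5 x_4^6 x_5^6. -/
theorem stmt19 (f : P5)
    (hf : f ∈ Submodule.span (ZMod 2)
      {x : P5 | ∃ σ : Equiv.Perm (Fin 5), x = rename (⇑σ) (mon 3 3 5 6 6)})
    (hinv : ∀ σ : Equiv.Perm (Fin 5),
      ∃ h p : P5, IsHit 23 h ∧ p ∈ PMinus 23 [3, 4, 3] ∧ rename (⇑σ) f - f = h + p) :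
    ∃ h p : P5, IsHit 23 h ∧ p ∈ PMinus 23 [3, 4, 3] ∧ f = h + p := by
  rw [← mem_hitMod]
  have hsum : ∑ τ ∈ doubleTranspositions, (rename τ f - f) ∈ hitMod 23 [3, 4, 3] :=
    Submodule.sum_mem _ fun τ _ => mem_hitMod.2 (hinv τ)
  rw [Finset.sum_sub_distrib, Finset.sum_const, card_doubleTranspositions,
    ← Nat.cast_smul_eq_nsmul (ZMod 2), show ((15 : ℕ) : ZMod 2) = 1 from rfl, one_smul] at hsum
  exact (Submodule.sub_mem_iff_right _
    (sum_rename_doubleTranspositions_mem_of_mem_span hf)).1 hsum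
end
end
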